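/- Let F(m(·)) = -½ ∬ φ(x-y) m(x) m(y) dx dy - (1/β) ∫ s(m(x)) dx be the free energy functional on the torus [-1/2,1/2)^d, where φ is real, even, integrable with ∫φ = 1 and φ_max = sup_{n≠0} φ_n ∈ (0, ∞), and s is concave and continuous. Then for every profile m(·) with mean m̄, F(m(·)) ≥ f_MF(β, m̄) - φ_max·(f_MF(βφ_max, m̄) - f_MF**(βφ_max, m̄)), where f_MF(β,m) = -m²/2 - (1/β)s(m). -/

import Mathlib

open MeasureTheory

/-- The unit cell `[-1/2, 1/2)^d` of the torus. -/
noncomputable def unitBox (d : ℕ) : Set (Fin d → ℝ) :=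
  Set.univ.pi fun _ => Set.Ico (-(1 / 2) : ℝ) (1 / 2)

/-- Fourier coefficient `φ_n = ∫ φ(x) cos(2π n·x) dx` of an even function. -/
noncomputable def fourierCoef (d : ℕ) (φ : (Fin d → ℝ) → ℝ) (n : Fin d → ℤ) : ℝ :=
  ∫ x in unitBox d, φ x * Real.cos (2 * Real.pi * ∑ i, (n i : ℝ) * x i)

/-- The convex envelope of `f` on the set `I`. -/
noncomputable def convEnvOn (I : Set ℝ) (f : ℝ → ℝ) (m : ℝ) : ℝ :=
  sSup {y : ℝ | ∃ g : ℝ → ℝ, ConvexOn ℝ I g ∧ (∀ x ∈ I, g x ≤ f x) ∧ y = g m}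

/-- The mean-field free energy `f_MF(β,m) = -m²/2 - (1/β) s(m)`. -/
noncomputable def fMF (s : ℝ → ℝ) (β m : ℝ) : ℝ := -m ^ 2 / 2 - (1 / β) * s m

section Torus

attribute [local instance] instMeasureSpaceUnitAddCircle
attribute [local instance] instIsAddHaarMeasureUnitAddCircleVolume
attribute [local instance] instIsProbabilityMeasureUnitAddCircleVolume

namespace UnitAddTorus

variable {ι : Type*} [Fintype ι]

lemma mFourier_apply_add (n : ι → ℤ) (x y : UnitAddTorus ι) :
    mFourier n (x + y) = mFourier n x * mFourier n y := by
  simp [mFourier, fourier_apply, smul_add, AddCircle.toCircle_add, Finset.prod_mul_distrib]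

lemma mFourierCoeff_comp_add_left (f : UnitAddTorus ι → ℂ) (z : UnitAddTorus ι) (n : ι → ℤ) :
    mFourierCoeff (fun t => f (z + t)) n = mFourier n z * mFourierCoeff f n := by
  have h : ∀ t, mFourier (-n) t • f (z + t)
      = mFourier n z * (mFourier (-n) (z + t) • f (z + t)) := by
    intro t
    have h1 : mFourier n z * mFourier (-n) z = 1 := by
      rw [← mFourier_add, add_neg_cancel, mFourier_zero]; rfl
    rw [mFourier_apply_add, smul_eq_mul, smul_eq_mul]
    linear_combination (-(mFourier (-n) t * f (z + t))) * h1
  simp only [mFourierCoeff]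
  rw [integral_congr_ae (.of_forall h), integral_const_mul,
    integral_add_left_eq_self (fun t => mFourier (-n) t • f t) z]

lemma mFourierCoeff_toLp_memLp {f : UnitAddTorus ι → ℂ} (hf : MemLp f 2) (n : ι → ℤ) :
    mFourierCoeff (hf.toLp f) n = mFourierCoeff f n := by
  refine integral_congr_ae ?_
  filter_upwards [hf.coeFn_toLp] with t ht
  rw [ht]

/-- Fourier expansion, at every point, of the autocorrelation of an `L²` function. -/
lemma hasSum_autocorrelation {f : UnitAddTorus ι → ℂ} (hf : MemLp f 2) (z : UnitAddTorus ι) :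
    HasSum (fun n => ((‖mFourierCoeff f n‖ ^ 2 : ℝ) : ℂ) * mFourier n z)
      (∫ t, (starRingEnd ℂ) (f t) * f (z + t)) := by
  have hg : MemLp (fun t => f (z + t)) 2 :=
    hf.comp_measurePreserving (measurePreserving_add_left volume z)
  have h := hasSum_prod_mFourierCoeff (hf.toLp f) (hg.toLp _)
  simp only [mFourierCoeff_toLp_memLp, mFourierCoeff_comp_add_left] at h
  convert! h using 1
  · ext n
    rw [← Complex.normSq_eq_norm_sq, Complex.normSq_eq_conj_mul_self]
    ring
  · refine integral_congr_ae ?_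
    filter_upwards [hf.coeFn_toLp, hg.coeFn_toLp] with t h1 h2
    rw [h1, h2]

/-- Spectral bound for the quadratic form of an integrable convolution kernel. -/
lemma integral_kernel_le {Φ M : UnitAddTorus ι → ℝ} {c : ℝ} (hΦ : Integrable Φ)
    (hM : MemLp M 2)
    (hone : ∫ t, Φ t = 1)
    (hc : ∀ n : ι → ℤ, n ≠ 0 → ∫ t, Φ t * (mFourier n t).re ≤ c)
    (hE : Integrable (fun p : UnitAddTorus ι × UnitAddTorus ι => Φ (p.1 - p.2) * M p.1 * M p.2)) :
    ∫ p : UnitAddTorus ι × UnitAddTorus ι, Φ (p.1 - p.2) * M p.1 * M p.2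
      ≤ (∫ t, M t) ^ 2 + c * ((∫ t, M t ^ 2) - (∫ t, M t) ^ 2) := by
  set f : UnitAddTorus ι → ℂ := fun t => (M t : ℂ) with hfdef
  have hf : MemLp f 2 := hM.ofReal
  set A : (ι → ℤ) → ℝ := fun n => ‖mFourierCoeff f n‖ ^ 2 with hA
  have hreal : ∀ z, (∫ t, (starRingEnd ℂ) (f t) * f (z + t)) = ((∫ t, M t * M (z + t) : ℝ) : ℂ) := by
    intro z
    rw [← integral_complex_ofReal]
    simp [hfdef]
  have hauto : ∀ z, HasSum (fun n => A n * (mFourier n z).re) (∫ t, M t * M (z + t)) := by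
    intro z
    have h := Complex.hasSum_re (hasSum_autocorrelation hf z)
    rw [hreal, Complex.ofReal_re] at h
    simpa only [Complex.re_ofReal_mul] using h
  have hpars : HasSum A (∫ t, M t ^ 2) := by
    simpa [mFourier, pow_two] using hauto 0
  have hre : ∀ n (z : UnitAddTorus ι), |(mFourier n z).re| ≤ 1 := fun n z =>
    (Complex.abs_re_le_norm _).trans ((mFourier n).norm_coe_le_norm z |>.trans_eq mFourier_norm)
  have hint : ∀ n, Integrable (fun z => Φ z * (A n * (mFourier n z).re)) := by
    intro n
    refine hΦ.mul_bdd (c := A n) (by fun_prop) (.of_forall fun z => ?_)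
    rw [norm_mul, Real.norm_eq_abs, Real.norm_eq_abs, abs_of_nonneg (by positivity)]
    exact mul_le_of_le_one_right (by positivity) (hre n z)
  have hsum : HasSum (fun n => A n * ∫ z, Φ z * (mFourier n z).re)
      (∫ z, Φ z * ∫ t, M t * M (z + t)) := by
    have h := hasSum_integral_of_summable_integral_norm hint ?_
    · convert! h using 1
      · ext n
        rw [← integral_const_mul]
        exact integral_congr_ae (.of_forall fun z => by ring)
      · refine integral_congr_ae (.of_forall fun z => ?_)
        exact ((hauto z).mul_left (Φ z)).tsum_eq.symm
    · refine Summable.of_nonneg_of_le (fun n => integral_nonneg fun _ => norm_nonneg _)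
        (fun n => ?_) (hpars.summable.mul_right (∫ z, ‖Φ z‖))
      rw [← integral_const_mul]
      refine integral_mono (hint n).norm (hΦ.norm.const_mul _) fun z => ?_
      simp only [norm_mul, Real.norm_eq_abs]
      rw [abs_of_nonneg (show 0 ≤ A n by positivity)]
      have := mul_le_mul_of_nonneg_left (hre n z) (show 0 ≤ A n * |Φ z| by positivity)
      linarith
  have hmp := measurePreserving_add_prod (volume : Measure (UnitAddTorus ι))
    (volume : Measure (UnitAddTorus ι))
  have hemb : MeasurableEmbedding
      (fun z : UnitAddTorus ι × UnitAddTorus ι => (z.1 + z.2, z.2)) := by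
    convert! (MeasurableEquiv.prodComm.trans ((MeasurableEquiv.shearAddRight (UnitAddTorus ι)).trans
      MeasurableEquiv.prodComm)).measurableEmbedding using 1
    ext z : 1
    exact Prod.ext (add_comm z.1 z.2) rfl
  have hQ : ∫ p : UnitAddTorus ι × UnitAddTorus ι, Φ (p.1 - p.2) * M p.1 * M p.2
      = ∫ z, Φ z * ∫ t, M t * M (z + t) := by
    rw [Measure.volume_eq_prod, ← hmp.integral_comp hemb, integral_prod]
    · refine integral_congr_ae (.of_forall fun z => ?_)
      simp only [add_sub_cancel_right]
      rw [← integral_const_mul]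
      exact integral_congr_ae (.of_forall fun t => by ring)
    · exact hmp.integrable_comp_of_integrable hE
  have hA0 : A 0 = (∫ t, M t) ^ 2 := by
    simp only [hA, mFourierCoeff, neg_zero, mFourier_zero, ContinuousMap.one_apply, one_smul,
      hfdef, integral_complex_ofReal, Complex.norm_real, Real.norm_eq_abs, sq_abs]
  have hfin := le_hasSum ((hpars.mul_left c).sub hsum) 0 fun n hn => by
    have := mul_le_mul_of_nonneg_left (hc n hn) (show 0 ≤ A n by positivity)
    linarith
  simp only [mFourier_zero, ContinuousMap.one_apply, Complex.one_re, mul_one, hone, hA0] at hfin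
  rw [hQ]
  linarith

end UnitAddTorus

/-- The representative in `unitBox d` of a point of the torus. -/
noncomputable def boxRep (d : ℕ) (t : UnitAddTorus (Fin d)) : Fin d → ℝ :=
  fun i => (AddCircle.equivIco 1 (-(1 / 2) : ℝ) (t i) : ℝ)

lemma boxRep_mem (d : ℕ) (t : UnitAddTorus (Fin d)) : boxRep d t ∈ unitBox d := fun i _ => by
  have h := (AddCircle.equivIco 1 (-(1 / 2) : ℝ) (t i)).2
  exact ⟨h.1, h.2.trans_eq (by norm_num)⟩

lemma coe_boxRep (d : ℕ) (t : UnitAddTorus (Fin d)) :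
    (fun i => (boxRep d t i : UnitAddCircle)) = t :=
  funext fun _ => AddCircle.coe_equivIco

lemma boxRep_coe {d : ℕ} {x : Fin d → ℝ} (hx : x ∈ unitBox d) :
    boxRep d (fun i => (x i : UnitAddCircle)) = x :=
  funext fun i => AddCircle.equivIco_coe_of_mem (by
    have h := hx i trivial
    exact ⟨h.1, h.2.trans_eq (by norm_num)⟩)

lemma measurableSet_unitBox (d : ℕ) : MeasurableSet (unitBox d) :=
  MeasurableSet.univ_pi fun _ => measurableSet_Ico

lemma measurable_coe_torus (d : ℕ) :
    Measurable (fun (x : Fin d → ℝ) (i : Fin d) => (x i : UnitAddCircle)) :=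
  measurable_pi_lambda _ fun i => AddCircle.measurable_mk'.comp (measurable_pi_apply i)

lemma measurable_boxRep (d : ℕ) : Measurable (boxRep d) :=
  measurable_pi_lambda _ fun i => measurable_subtype_coe.comp
    ((AddCircle.measurableEquivIco 1 (-(1 / 2) : ℝ)).measurable.comp (measurable_pi_apply i))

lemma measurableEmbedding_boxRep (d : ℕ) : MeasurableEmbedding (boxRep d) := by
  refine .of_measurable_inverse (measurable_boxRep d) ?_ (measurable_coe_torus d) (coe_boxRep d)
  convert! measurableSet_unitBox d
  ext x
  exact ⟨fun ⟨t, ht⟩ => ht ▸ boxRep_mem d t, fun hx => ⟨_, boxRep_coe hx⟩⟩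

lemma measurePreserving_coe_torus (d : ℕ) :
    MeasurePreserving (fun (x : Fin d → ℝ) (i : Fin d) => (x i : UnitAddCircle))
      (volume.restrict (unitBox d)) volume := by
  have h := measurePreserving_pi (fun _ : Fin d => volume.restrict (Set.Ico (-(1 / 2) : ℝ) (1 / 2)))
    (fun _ => AddCircle.haarAddCircle)
    (f := fun _ (x : ℝ) => (x : UnitAddCircle)) (fun _ => by
      rw [Measure.restrict_congr_set Ico_ae_eq_Ioc]
      convert! AddCircle.measurePreserving_mk 1 (-(1 / 2) : ℝ) using 1
      · norm_num
      · simp [volume, AddCircle.haarAddCircle])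
  rwa [← Measure.restrict_pi_pi] at h

lemma measurePreserving_boxRep (d : ℕ) :
    MeasurePreserving (boxRep d) volume (volume.restrict (unitBox d)) := by
  refine ⟨measurable_boxRep d, ?_⟩
  rw [← (measurePreserving_coe_torus d).map_eq,
    Measure.map_map (measurable_boxRep d) (measurable_coe_torus d)]
  refine (Measure.map_congr (g := id) ?_).trans Measure.map_id
  exact (ae_restrict_mem (measurableSet_unitBox d)).mono fun x hx => boxRep_coe hx

lemma mFourier_coe_re {d : ℕ} (n : Fin d → ℤ) (x : Fin d → ℝ) :
    (UnitAddTorus.mFourier n (fun i => (x i : UnitAddCircle))).re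
      = Real.cos (2 * Real.pi * ∑ i, (n i : ℝ) * x i) := by
  have h : UnitAddTorus.mFourier n (fun i => (x i : UnitAddCircle))
      = Complex.exp ((2 * Real.pi * ∑ i, (n i : ℝ) * x i : ℝ) * Complex.I) := by
    simp only [UnitAddTorus.mFourier, ContinuousMap.coe_mk, fourier_coe_apply, ← Complex.exp_sum]
    congr 1
    push_cast
    rw [Finset.mul_sum, Finset.sum_mul]
    exact Finset.sum_congr rfl fun i _ => by ring
  rw [h, Complex.exp_ofReal_mul_I_re]

/-- A `ℤ^d`-periodic function factors through differences of representatives. -/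
lemma periodic_boxRep_sub {d : ℕ} {φ : (Fin d → ℝ) → ℝ}
    (hper : ∀ (x : Fin d → ℝ) (n : Fin d → ℤ), φ (x + fun i => (n i : ℝ)) = φ x)
    (t u : UnitAddTorus (Fin d)) : φ (boxRep d (t - u)) = φ (boxRep d t - boxRep d u) := by
  have h : ∀ i, ∃ k : ℤ, boxRep d (t - u) i = boxRep d t i - boxRep d u i + k := by
    intro i
    have h1 : ((boxRep d (t - u) i - (boxRep d t i - boxRep d u i) : ℝ) : UnitAddCircle) = 0 := by
      rw [AddCircle.coe_sub, AddCircle.coe_sub, congrFun (coe_boxRep d (t - u)) i, congrFun (coe_boxRep d t) i,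
        congrFun (coe_boxRep d u) i]
      simp
    obtain ⟨k, hk⟩ := (AddCircle.coe_eq_zero_iff 1).1 h1
    exact ⟨k, by simp at hk; linarith⟩
  choose k hk using h
  rw [← hper (boxRep d t - boxRep d u) k]
  exact congrArg φ (funext hk)

/-- Spectral bound for the interaction energy on the unit cell. -/
lemma integral_interaction_le {d : ℕ} {φ m : (Fin d → ℝ) → ℝ} {c : ℝ}
    (hper : ∀ (x : Fin d → ℝ) (n : Fin d → ℤ), φ (x + fun i => (n i : ℝ)) = φ x)
    (hφint : IntegrableOn φ (unitBox d)) (hnorm : (∫ x in unitBox d, φ x) = 1)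
    (hc : ∀ n : Fin d → ℤ, n ≠ 0 → fourierCoef d φ n ≤ c)
    (hm : MemLp m 2 (volume.restrict (unitBox d)))
    (hE : IntegrableOn (fun p : (Fin d → ℝ) × (Fin d → ℝ) => φ (p.1 - p.2) * m p.1 * m p.2)
      (unitBox d ×ˢ unitBox d)) :
    (∫ p in unitBox d ×ˢ unitBox d, φ (p.1 - p.2) * m p.1 * m p.2)
      ≤ (∫ x in unitBox d, m x) ^ 2
        + c * ((∫ x in unitBox d, m x ^ 2) - (∫ x in unitBox d, m x) ^ 2) := by
  have hp := measurePreserving_boxRep d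
  have he := measurableEmbedding_boxRep d
  have hp2 := hp.prod hp
  have he2 := he.prodMap he
  rw [IntegrableOn, Measure.volume_eq_prod, ← Measure.prod_restrict,
    ← hp2.integrable_comp_emb he2] at hE
  rw [Measure.volume_eq_prod, ← Measure.prod_restrict, ← hp2.integral_comp he2,
    ← hp.integral_comp he, ← hp.integral_comp he]
  simp only [Function.comp_def, Prod.map, ← periodic_boxRep_sub hper] at hE ⊢
  refine UnitAddTorus.integral_kernel_le (Φ := fun t => φ (boxRep d t))
    (M := fun t => m (boxRep d t)) ((hp.integrable_comp_emb he).2 hφint)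
    (hm.comp_measurePreserving hp) ?_ (fun n hn => ?_) hE
  · rw [hp.integral_comp he, hnorm]
  · refine le_trans (le_of_eq ?_) (hc n hn)
    rw [fourierCoef, ← hp.integral_comp he]
    simp only [← mFourier_coe_re, coe_boxRep]

end Torus

/-- A convex function on an interval has a supporting line at every interior point. -/
lemma ConvexOn.exists_supporting_line {a b x : ℝ} {g : ℝ → ℝ} (hg : ConvexOn ℝ (Set.Icc a b) g)
    (hx : x ∈ Set.Ioo a b) : ∃ k : ℝ, ∀ y ∈ Set.Icc a b, g x + k * (y - x) ≤ g y := by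
  have hi : x ∈ interior (Set.Icc a b) := by rwa [interior_Icc]
  refine ⟨derivWithin g (Set.Ioi x) x, fun y hy => ?_⟩
  rcases lt_trichotomy x y with h | rfl | h
  · have := hg.rightDeriv_le_slope_of_mem_interior hi hy h
    rw [slope_def_field, le_div_iff₀ (by linarith)] at this
    linarith
  · simp
  · have := (hg.slope_le_leftDeriv_of_mem_interior hy hi h).trans
      (hg.leftDeriv_le_rightDeriv_of_mem_interior hi)
    rw [slope_def_field, div_le_iff₀ (by linarith)] at this
    linarith

/-- Jensen's inequality for the convex envelope on a compact interval. -/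
lemma convEnvOn_integral_le {α : Type*} [MeasurableSpace α] {μ : Measure α}
    [IsProbabilityMeasure μ] {a b : ℝ} {f : ℝ → ℝ} (hf : ContinuousOn f (Set.Icc a b))
    {m : α → ℝ} (hrange : ∀ x, m x ∈ Set.Icc a b) (hm : Integrable m μ)
    (hfm : Integrable (fun x => f (m x)) μ) :
    convEnvOn (Set.Icc a b) f (∫ x, m x ∂μ) ≤ ∫ x, f (m x) ∂μ := by
  obtain ⟨x₀⟩ := μ.nonempty_of_neZero
  obtain ⟨c, hcm, hc⟩ := isCompact_Icc.exists_isMinOn ⟨m x₀, hrange x₀⟩ hf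
  refine csSup_le ⟨_, fun _ => f c, convexOn_const _ (convex_Icc a b), fun x hx => hc hx, rfl⟩ ?_
  rintro _ ⟨g, hg, hgf, rfl⟩
  set A := ∫ x, m x ∂μ with hA
  have hconst : ∀ r : ℝ, ∫ _, r ∂μ = r := by simp
  have ha : a ≤ A := by
    rw [← hconst a]
    exact integral_mono (integrable_const _) hm fun x => (hrange x).1
  have hb : A ≤ b := by
    rw [← hconst b]
    exact integral_mono hm (integrable_const _) fun x => (hrange x).2
  have hend : (∀ᵐ x ∂μ, m x = A) → g A ≤ ∫ x, f (m x) ∂μ := by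
    intro h
    rw [integral_congr_ae (h.mono fun x hx => congrArg f hx), hconst]
    exact hgf A ⟨ha, hb⟩
  rcases ha.eq_or_lt with ha | ha
  · refine hend ?_
    have h0 := (integral_eq_zero_iff_of_nonneg (fun x => sub_nonneg.2 (hrange x).1)
      (hm.sub (integrable_const a))).1
      (by rw [integral_sub hm (integrable_const _), hconst, ← hA, ← ha, sub_self])
    exact h0.mono fun x hx => by rw [← ha]; exact sub_eq_zero.1 hx
  rcases hb.eq_or_lt with hb | hb
  · refine hend ?_
    have h0 := (integral_eq_zero_iff_of_nonneg (fun x => sub_nonneg.2 (hrange x).2)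
      ((integrable_const b).sub hm)).1
      (by rw [integral_sub (integrable_const _) hm, hconst, ← hA, ← hb, sub_self])
    exact h0.mono fun x hx => by rw [hb]; exact (sub_eq_zero.1 hx).symm
  obtain ⟨k, hk⟩ := hg.exists_supporting_line ⟨ha, hb⟩
  have hi : Integrable (fun x => k * (m x - A)) μ := (hm.sub (integrable_const A)).const_mul k
  calc g A = ∫ x, g A + k * (m x - A) ∂μ := by
        rw [integral_add (integrable_const _) hi, integral_const_mul,
          integral_sub hm (integrable_const _), hconst, hconst, ← hA]
        ring
    _ ≤ ∫ x, f (m x) ∂μ := integral_mono ((integrable_const _).add hi) hfm fun x =>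
        (hk _ (hrange x)).trans (hgf _ (hrange x))

/-- Central lower bound on the free energy functional: for every profile `m` with
mean `m̄`, `F(m(·)) ≥ f_MF(β,m̄) - φ_max (f_MF(βφ_max,m̄) - f_MF**(βφ_max,m̄))`. -/
theorem stmt16 (d : ℕ) (hd : 0 < d) (φ : (Fin d → ℝ) → ℝ) (s : ℝ → ℝ)
    (β : ℝ) (hβ : 0 < β)
    (heven : ∀ x, φ (-x) = φ x)
    (hper : ∀ (x : Fin d → ℝ) (n : Fin d → ℤ), φ (x + fun i => (n i : ℝ)) = φ x)
    (hφint : IntegrableOn φ (unitBox d))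
    (hnorm : (∫ x in unitBox d, φ x) = 1)
    (hs : ConcaveOn ℝ Set.univ s) (hscont : Continuous s)
    (φmax : ℝ)
    (hφmax : IsLUB (Set.range fun n : {n : Fin d → ℤ // n ≠ 0} => fourierCoef d φ n.1) φmax)
    (hφmaxpos : 0 < φmax)
    (a b : ℝ) (hab : a ≤ b)
    (m : (Fin d → ℝ) → ℝ) (hrange : ∀ x, m x ∈ Set.Icc a b)
    (hmint : IntegrableOn m (unitBox d))
    (hsint : IntegrableOn (fun x => s (m x)) (unitBox d))
    (hEint : IntegrableOn
      (fun p : (Fin d → ℝ) × (Fin d → ℝ) => φ (p.1 - p.2) * m p.1 * m p.2)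
      (unitBox d ×ˢ unitBox d)) :
    fMF s β (∫ x in unitBox d, m x)
      - φmax * (fMF s (β * φmax) (∫ x in unitBox d, m x)
          - convEnvOn (Set.Icc a b) (fMF s (β * φmax)) (∫ x in unitBox d, m x))
      ≤ -(1 / 2) * (∫ p in unitBox d ×ˢ unitBox d, φ (p.1 - p.2) * m p.1 * m p.2)
          - (1 / β) * ∫ x in unitBox d, s (m x) := by
  have hprob : IsProbabilityMeasure (volume.restrict (unitBox d)) := ⟨by
    rw [Measure.restrict_apply_univ, unitBox, volume_pi_pi]
    norm_num⟩
  have hbound : ∀ x, ‖m x‖ ≤ max |a| |b| := fun x =>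
    abs_le_max_abs_abs (hrange x).1 (hrange x).2
  have hm2 : MemLp m 2 (volume.restrict (unitBox d)) :=
    .of_bound hmint.aestronglyMeasurable _ (.of_forall hbound)
  have hsq : Integrable (fun x => m x ^ 2) (volume.restrict (unitBox d)) := hm2.integrable_sq
  have hQ := integral_interaction_le hper hφint hnorm
    (fun n hn => hφmax.1 ⟨⟨n, hn⟩, rfl⟩) hm2 hEint
  have hsq' : Integrable (fun x => -m x ^ 2 / 2) (volume.restrict (unitBox d)) :=
    hsq.neg.div_const 2
  have hs' := hsint.const_mul (1 / (β * φmax))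
  have hJ := convEnvOn_integral_le (μ := volume.restrict (unitBox d)) (a := a) (b := b)
    (f := fMF s (β * φmax))
    (by unfold fMF; fun_prop) hrange hmint (hsq'.sub hs')
  have hI : ∫ x in unitBox d, fMF s (β * φmax) (m x)
      = -(∫ x in unitBox d, m x ^ 2) / 2
        - (1 / (β * φmax)) * ∫ x in unitBox d, s (m x) := by
    simp only [fMF]
    rw [integral_sub hsq' hs', integral_const_mul, integral_div, integral_neg]
  rw [hI] at hJ
  have hJ' := mul_le_mul_of_nonneg_left hJ hφmaxpos.le
  have hcancel : ∀ r : ℝ, φmax * (1 / (β * φmax) * r) = 1 / β * r := fun r => by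
    field_simp
  rw [mul_sub, hcancel] at hJ'
  rw [mul_sub, fMF, fMF, mul_sub φmax, hcancel]
  linarith
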